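/- arXiv:2304.09123 — 2 statements merged into one kernel-verified Lean document; each statement's English description precedes it below -/
import Mathlib

section
/- The normalizing constant of the Gibbs measure satisfies Λ := ∫_{ℝ^N} exp(−βJ(w)) dw ≤ 3^{βb/2} · (3π/(mβ))^{N/2}. -/
open MeasureTheory Real
open scoped InnerProductSpace

lemma gibbs_lower_bound {N : ℕ} (J : EuclideanSpace ℝ (Fin N) → ℝ) (m b : ℝ)
    (hJnonneg : ∀ x, 0 ≤ J x) (hJ : Differentiable ℝ J)
    (hdiss : ∀ x, m * ‖x‖ ^ 2 - b ≤ ⟪x, gradient J x⟫_ℝ) (x : EuclideanSpace ℝ (Fin N)) :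
    m / 3 * ‖x‖ ^ 2 - b / 2 * Real.log 3 ≤ J x := by
  have hd : ∀ t : ℝ, 0 < t → HasDerivAt
      (fun t : ℝ => J (t • x) - m * ‖x‖ ^ 2 / 2 * t ^ 2 + b * Real.log t)
      (⟪gradient J (t • x), x⟫_ℝ - m * ‖x‖ ^ 2 / 2 * (2 * t) + b * t⁻¹) t := by
    intro t ht
    have h1 : HasDerivAt (fun t : ℝ => t • x) x t := by
      simpa using (hasDerivAt_id t).smul_const x
    have h2 := (hJ (t • x)).hasGradientAt.hasFDerivAt.comp_hasDerivAt t h1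
    have h3 : HasDerivAt (fun t : ℝ => t ^ 2) (2 * t) t := by
      simpa using hasDerivAt_pow 2 t
    have h4 := (h2.sub (h3.const_mul (m * ‖x‖ ^ 2 / 2))).add
      ((Real.hasDerivAt_log ht.ne').const_mul b)
    exact h4
  have hs : 0 < Real.sqrt 3 := by positivity
  have hs1 : 1 ≤ Real.sqrt 3 := by
    rw [Real.one_le_sqrt]; norm_num
  have hc : 0 < (Real.sqrt 3)⁻¹ := by positivity
  have hc1 : (Real.sqrt 3)⁻¹ ≤ 1 := inv_le_one_of_one_le₀ hs1
  have hmono : MonotoneOn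
      (fun t : ℝ => J (t • x) - m * ‖x‖ ^ 2 / 2 * t ^ 2 + b * Real.log t)
      (Set.Icc (Real.sqrt 3)⁻¹ 1) := by
    apply monotoneOn_of_deriv_nonneg (convex_Icc _ _)
    · intro t ht
      exact (hd t (hc.trans_le ht.1)).continuousAt.continuousWithinAt
    · intro t ht
      rw [interior_Icc] at ht
      exact (hd t (hc.trans ht.1)).differentiableAt.differentiableWithinAt
    · intro t ht
      rw [interior_Icc] at ht
      have ht0 : 0 < t := hc.trans ht.1
      rw [(hd t ht0).deriv]
      have h := hdiss (t • x)
      rw [inner_smul_left, norm_smul, Real.norm_of_nonneg ht0.le, real_inner_comm] at h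
      simp only [conj_trivial] at h
      have h5 : 0 ≤ t⁻¹ * (t * ⟪gradient J (t • x), x⟫_ℝ - (m * (t * ‖x‖) ^ 2 - b)) :=
        mul_nonneg (by positivity) (by linarith)
      have h6 : t⁻¹ * (t * ⟪gradient J (t • x), x⟫_ℝ - (m * (t * ‖x‖) ^ 2 - b))
          = ⟪gradient J (t • x), x⟫_ℝ - m * ‖x‖ ^ 2 / 2 * (2 * t) + b * t⁻¹ := by
        field_simp
        ring
      rw [← h6]; exact h5
  have h := hmono (Set.left_mem_Icc.2 hc1) (Set.right_mem_Icc.2 hc1) hc1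
  simp only [one_smul, Real.log_one, Real.log_inv, inv_pow,
    Real.sq_sqrt (show (0 : ℝ) ≤ 3 by norm_num),
    Real.log_sqrt (show (0 : ℝ) ≤ 3 by norm_num)] at h
  have := hJnonneg ((Real.sqrt 3)⁻¹ • x)
  linarith

/-- **Bound on the normalizing constant of the Gibbs measure.**
`Λ := ∫_{ℝ^N} exp(−βJ(w)) dw ≤ 3^{βb/2} · (3π/(mβ))^{N/2}`. -/
theorem gibbs_normalizing_constant_bound
    (N : ℕ) (hN : 1 ≤ N)
    (J : EuclideanSpace ℝ (Fin N) → ℝ)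
    (A B LgradJ m b β : ℝ)
    (hJnonneg : ∀ x, 0 ≤ J x)
    (hJC2 : ContDiff ℝ 2 J)
    (hA : A = |J 0|)
    (hB : B = ‖gradient J 0‖)
    (hsmooth : ∀ x y, ‖gradient J x - gradient J y‖ ≤ LgradJ * ‖x - y‖)
    (hm : 0 < m) (hb : 0 ≤ b)
    (hdiss : ∀ x, m * ‖x‖ ^ 2 - b ≤ ⟪x, gradient J x⟫_ℝ)
    (hβ : 0 < β) :
    (∫ w : EuclideanSpace ℝ (Fin N), Real.exp (-β * J w)) ≤
      (3 : ℝ) ^ (β * b / 2) * (3 * π / (m * β)) ^ ((N : ℝ) / 2) := by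
  have hc : 0 < β * m / 3 := by positivity
  have hG := GaussianFourier.integral_rexp_neg_mul_sq_norm
    (V := EuclideanSpace ℝ (Fin N)) hc
  have hpos : 0 < (π / (β * m / 3)) ^ ((N : ℝ) / 2) := by positivity
  rw [finrank_euclideanSpace_fin] at hG
  have hint : Integrable (fun v : EuclideanSpace ℝ (Fin N) =>
      Real.exp (-(β * m / 3) * ‖v‖ ^ 2)) := by
    by_contra hn
    rw [integral_undef hn] at hG
    linarith
  have hle : ∀ w : EuclideanSpace ℝ (Fin N), Real.exp (-β * J w) ≤
      (3 : ℝ) ^ (β * b / 2) * Real.exp (-(β * m / 3) * ‖w‖ ^ 2) := by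
    intro w
    have h := gibbs_lower_bound J m b hJnonneg (hJC2.differentiable (by norm_num)) hdiss w
    rw [Real.rpow_def_of_pos (by norm_num), ← Real.exp_add]
    apply Real.exp_le_exp.2
    have := mul_le_mul_of_nonneg_left h hβ.le
    linarith
  calc (∫ w : EuclideanSpace ℝ (Fin N), Real.exp (-β * J w))
      ≤ ∫ w : EuclideanSpace ℝ (Fin N),
          (3 : ℝ) ^ (β * b / 2) * Real.exp (-(β * m / 3) * ‖w‖ ^ 2) :=
        integral_mono_of_nonneg (Filter.Eventually.of_forall fun w => (Real.exp_pos _).le)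
          (hint.const_mul _) (Filter.Eventually.of_forall hle)
    _ = (3 : ℝ) ^ (β * b / 2) * (3 * π / (m * β)) ^ ((N : ℝ) / 2) := by
        rw [integral_const_mul, hG]
        congr 2
        field_simp
end

section
/- The Gibbs density is a stationary solution of the Fokker–Planck equation of the generalized Langevin diffusion: for all α ∈ ℝ^N, (1/2)Δ(σ(α)² p(α)) − div(f(α) p(α)) = 0, where p(α) := exp(−βJ(α))/Λ, f(α) := (−(β/2)σ(α)∇J(α) + ∇σ(α))·σ(α), and the diffusion matrix is σ(α)² I_N; equivalently, (1/2)Δ(σ(α)² e^{−βJ(α)}) = div((−(β/2)σ(α)²∇J(α) + σ(α)∇σ(α)) e^{−βJ(α)}) for all α ∈ ℝ^N. (Lemma: the generalized Langevin diffusion dθ = [−(β/2)∇J(θ)dt + ∇σ(θ)dt + dW(t)]σ(θ) has the Gibbs measure as stationary measure.) -/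
open MeasureTheory Real
open scoped InnerProductSpace

/-- The Laplacian of a scalar field on `ℝ^N`, as the sum of second partial
derivatives along the coordinate directions. -/
noncomputable def laplacian {N : ℕ} (f : EuclideanSpace ℝ (Fin N) → ℝ)
    (x : EuclideanSpace ℝ (Fin N)) : ℝ :=
  ∑ i : Fin N,
    fderiv ℝ (fun y => fderiv ℝ f y (EuclideanSpace.single i 1)) x
      (EuclideanSpace.single i 1)

/-- The divergence of a vector field on `ℝ^N`. -/
noncomputable def diverg {N : ℕ}
    (F : EuclideanSpace ℝ (Fin N) → EuclideanSpace ℝ (Fin N))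
    (x : EuclideanSpace ℝ (Fin N)) : ℝ :=
  ∑ i : Fin N, fderiv ℝ (fun y => F y i) x (EuclideanSpace.single i 1)

/-- **Lemma (the Gibbs density is stationary for the generalized Langevin diffusion).**
For all `α ∈ ℝ^N`, `(1/2)Δ(σ(α)² p(α)) − div(f(α) p(α)) = 0`, where
`p(α) := exp(−βJ(α))/Λ` and `f(α) := (−(β/2)σ(α)∇J(α) + ∇σ(α))·σ(α)`, the diffusion
matrix being `σ(α)² I_N`. -/
theorem gibbs_stationary_fokkerPlanck
    (N : ℕ) (hN : 1 ≤ N)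
    (J σ : EuclideanSpace ℝ (Fin N) → ℝ)
    (β Λ : ℝ) (hβ : 0 < β)
    (hJC2 : ContDiff ℝ 2 J)
    (hσC2 : ContDiff ℝ 2 σ)
    (hσpos : ∀ x, 0 < σ x)
    (hint : Integrable (fun α : EuclideanSpace ℝ (Fin N) => Real.exp (-β * J α)))
    (hΛ : Λ = ∫ α : EuclideanSpace ℝ (Fin N), Real.exp (-β * J α)) :
    ∀ α : EuclideanSpace ℝ (Fin N),
      (1 / 2) *
          laplacian (fun y => σ y ^ 2 * (Real.exp (-β * J y) / Λ)) α -
        diverg (fun y => (Real.exp (-β * J y) / Λ) •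
          (σ y • ((-(β / 2) * σ y) • gradient J y + gradient σ y))) α = 0 := by
  intro α
  have hg : ∀ (f : EuclideanSpace ℝ (Fin N) → ℝ) (y : EuclideanSpace ℝ (Fin N)) (i : Fin N),
      (gradient f y) i = fderiv ℝ f y (EuclideanSpace.single i 1) := by
    intro f y i
    have h : inner ℝ (gradient f y) (EuclideanSpace.single i (1 : ℝ))
        = fderiv ℝ f y (EuclideanSpace.single i 1) := by
      simp only [gradient, InnerProductSpace.toDual_symm_apply]
    rw [← h, EuclideanSpace.inner_single_right]
    simp
  have hJd : Differentiable ℝ J := hJC2.differentiable (by norm_num)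
  have hσd : Differentiable ℝ σ := hσC2.differentiable (by norm_num)
  have key : ∀ (i : Fin N) (y : EuclideanSpace ℝ (Fin N)),
      fderiv ℝ (fun y => σ y ^ 2 * (Real.exp (-β * J y) / Λ)) y (EuclideanSpace.single i 1)
      = (2 : ℝ) • ((Real.exp (-β * J y) / Λ) •
          (σ y • ((-(β / 2) * σ y) • gradient J y + gradient σ y))) i := by
    intro i y
    have h := ((hσd y).hasFDerivAt.pow 2).mul
      (((hJd y).hasFDerivAt.const_mul (-β)).exp.mul_const Λ⁻¹)
    have h2 : HasFDerivAt (fun y => σ y ^ 2 * (Real.exp (-β * J y) / Λ)) _ y := h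
    rw [h2.fderiv]
    simp [hg]
    ring
  unfold laplacian diverg
  rw [Finset.mul_sum, ← Finset.sum_sub_distrib]
  refine Finset.sum_eq_zero fun i _ => ?_
  simp only [key i]
  have hc : ∀ g : EuclideanSpace ℝ (Fin N) → ℝ,
      fderiv ℝ (fun y => (2 : ℝ) • g y) α = (2 : ℝ) • fderiv ℝ g α := fun g =>
    congrFun (fderiv_const_smul_field (𝕜 := ℝ) (f := g) (2 : ℝ)) α
  rw [hc]
  simp only [ContinuousLinearMap.smul_apply, smul_eq_mul]
  ring
end
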